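/- If G and H are (e)-positive labelled graphs, then the concatenation G + H^r is e-positive. -/

import Mathlib

open scoped Classical
noncomputable section

/-- Words of length `d` in the positive integers. -/
abbrev NCWord (d : ℕ) := Fin d → ℕ+

/-- `M_d`: coefficient functions of homogeneous degree-`d` series in
noncommuting variables. -/
abbrev Md (d : ℕ) := NCWord d → ℚ

/-- `Y_G`, the chromatic symmetric function of a labelled graph in
noncommuting variables, as an element of `M_d`. -/
def YG {d : ℕ} (G : SimpleGraph (Fin d)) : Md d :=
  fun w => if ∀ j k : Fin d, G.Adj j k → w j ≠ w k then 1 else 0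

/-- Set partitions of `{0, …, d-1}`. -/
abbrev SetPtn (d : ℕ) := Finpartition (Finset.univ : Finset (Fin d))

/-- `j` and `k` lie in a common block of `π`. -/
def sameBlock {d : ℕ} (π : SetPtn d) (j k : Fin d) : Prop :=
  ∃ B ∈ π.parts, j ∈ B ∧ k ∈ B

/-- The elementary symmetric function `e_π` in noncommuting variables. -/
def eSP {d : ℕ} (π : SetPtn d) : Md d :=
  fun w => if ∀ j k : Fin d, j ≠ k → sameBlock π j k → w j ≠ w k then 1 else 0

/-- The block of `π` containing `a`. -/
def blockOf {d : ℕ} (π : SetPtn d) (a : Fin d) : Finset (Fin d) :=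
  Finset.univ.filter fun k => sameBlock π a k

/-- The type of a set partition relative to the distinguished element `a`:
the multiset of sizes of the blocks not containing `a` (an integer partition),
together with the size of the block containing `a`. -/
def ptype {d : ℕ} (π : SetPtn d) (a : Fin d) : Multiset ℕ × ℕ :=
  ((π.parts.erase (blockOf π a)).val.map Finset.card, (blockOf π a).card)

/-- `K_d`: the span of the differences `e_{π₁} - e_{π₂}` over pairs of set
partitions of equal type (relative to the distinguished element `a`). -/
def Ksub {d : ℕ} (a : Fin d) : Submodule ℚ (Md d) :=
  Submodule.span ℚ
    {f | ∃ π₁ π₂ : SetPtn d, ptype π₁ a = ptype π₂ a ∧ f = eSP π₁ - eSP π₂}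

/-- `(e)`-positivity of a labelled graph, with distinguished vertex `a`:
`Y_G` is congruent modulo `K_d` to a nonnegative combination of `e_π`'s. -/
def IsEPosNCAt {d : ℕ} (G : SimpleGraph (Fin d)) (a : Fin d) : Prop :=
  ∃ (s : Finset (SetPtn d)) (c : SetPtn d → ℚ),
    (∀ π, 0 ≤ c π) ∧ YG G - ∑ π ∈ s, c π • eSP π ∈ Ksub a

/-- Induction `↑ : M_d → M_{d+1}`. -/
def induct {d : ℕ} (f : Md d) : Md (d + 1) :=
  fun w => if w (Fin.last d) = w ⟨d - 1, by omega⟩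
    then f (fun t => w t.castSucc) else 0

/-- Concatenation of labelled graphs: identify the last vertex of `G` with
the first vertex of `H`. -/
def concatG {p q : ℕ} (G : SimpleGraph (Fin p)) (H : SimpleGraph (Fin q)) :
    SimpleGraph (Fin (p + q - 1)) :=
  SimpleGraph.fromRel fun a b =>
    (∃ i j : Fin p, G.Adj i j ∧ (a : ℕ) = (i : ℕ) ∧ (b : ℕ) = (j : ℕ)) ∨
    (∃ i j : Fin q, H.Adj i j ∧ (a : ℕ) = (i : ℕ) + (p - 1) ∧ (b : ℕ) = (j : ℕ) + (p - 1))

/-- The reverse graph `G^r`. -/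
def revG {d : ℕ} (G : SimpleGraph (Fin d)) : SimpleGraph (Fin d) :=
  SimpleGraph.comap (fun i : Fin d => (⟨d - 1 - (i : ℕ), by have := i.isLt; omega⟩ : Fin d)) G

/-- A labelled graph: a simple graph on vertex set `{0, …, n-1}`, `n ≥ 1`. -/
structure LGraph where
  n : ℕ
  npos : 0 < n
  G : SimpleGraph (Fin n)

/-- The last vertex of a labelled graph. -/
def LGraph.last (A : LGraph) : Fin A.n := ⟨A.n - 1, by have := A.npos; omega⟩

/-- A labelled graph is `(e)`-positive (at its last vertex). -/
def LGraph.EPosNC (A : LGraph) : Prop := IsEPosNCAt A.G A.last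

/-- Concatenation, as an operation on labelled graphs. -/
def LGraph.concat (A B : LGraph) : LGraph :=
  ⟨A.n + B.n - 1, by have := A.npos; have := B.npos; omega, concatG A.G B.G⟩

/-- Reversal, as an operation on labelled graphs. -/
def LGraph.rev (A : LGraph) : LGraph := ⟨A.n, A.npos, revG A.G⟩

/-- Appendable `(e)`-positivity: `G + H` is `(e)`-positive for every
`(e)`-positive labelled graph `G`. -/
def LGraph.Appendable (H : LGraph) : Prop :=
  ∀ A : LGraph, A.EPosNC → (A.concat H).EPosNC

/-- The chromatic symmetric polynomial of `G` in `n` commuting variables. -/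
def cspoly {V : Type} [Fintype V] [DecidableEq V] (G : SimpleGraph V) (n : ℕ) :
    MvPolynomial (Fin n) ℚ :=
  ∑ κ ∈ Finset.univ.filter (fun κ : V → Fin n => ∀ u v : V, G.Adj u v → κ u ≠ κ v),
    ∏ v : V, MvPolynomial.X (κ v)

/-- `e`-positivity of a finite graph. -/
def EPos {V : Type} [Fintype V] [DecidableEq V] (G : SimpleGraph V) : Prop :=
  ∃ c : Nat.Partition (Fintype.card V) → ℚ, (∀ p, 0 ≤ c p) ∧
    ∀ n : ℕ, cspoly G n =
      ∑ p : Nat.Partition (Fintype.card V),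
        c p • (p.parts.map fun r => MvPolynomial.esymm (Fin n) ℚ r).prod

/-- Closed neighbourhood of a vertex, as a finset. -/
def closedNbhd {d : ℕ} (G : SimpleGraph (Fin d)) (i : Fin d) : Finset (Fin d) :=
  Finset.univ.filter fun k => k = i ∨ G.Adj i k

/-- `m_i`: the largest label in the closed neighbourhood of `i`. -/
def mIdx {d : ℕ} (G : SimpleGraph (Fin d)) (i : Fin d) : Fin d :=
  (closedNbhd G i).max' ⟨i, by simp [closedNbhd]⟩

/-- `w_i`: the smallest label in the closed neighbourhood of `i`. -/
def wIdx {d : ℕ} (G : SimpleGraph (Fin d)) (i : Fin d) : Fin d :=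
  (closedNbhd G i).min' ⟨i, by simp [closedNbhd]⟩

/-- Labelled unit interval graph. -/
def IsUnitInterval {d : ℕ} (G : SimpleGraph (Fin d)) : Prop :=
  ∀ i v w j : Fin d, i ≤ v → v < w → w ≤ j → G.Adj i j → G.Adj v w

/-- An acyclic orientation of a graph, as an asymmetric relation with
irreflexive transitive closure whose symmetrization matches adjacency. -/
def IsAcyclicOrientation {V : Type} (G : SimpleGraph V) (r : V → V → Prop) : Prop :=
  (∀ a b, r a b → ¬ r b a) ∧
  (∀ a b, a ≠ b → ((r a b ∨ r b a) ↔ G.Adj a b)) ∧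
  Irreflexive (Relation.TransGen r)

/-- The set of sinks of an orientation. -/
def sinkSet {V : Type} [Fintype V] (r : V → V → Prop) : Finset V :=
  Finset.univ.filter fun x => ∀ y, ¬ r x y

/-- The labelled path `P_d`. -/
def PathG (d : ℕ) : SimpleGraph (Fin d) :=
  SimpleGraph.fromRel fun a b => (b : ℕ) = (a : ℕ) + 1

/-- The labelled cycle `C_d`. -/
def CycleG (d : ℕ) : SimpleGraph (Fin d) :=
  SimpleGraph.fromRel fun a b => (b : ℕ) = (a : ℕ) + 1 ∨ ((a : ℕ) = 0 ∧ (b : ℕ) = d - 1)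

/-- A family of polynomials, one for each number of variables, that is a nonnegative
combination of products of elementary symmetric polynomials of total degree `N`. -/
def EPosFamily (N : ℕ) (f : ∀ n : ℕ, MvPolynomial (Fin n) ℚ) : Prop :=
  ∃ c : Nat.Partition N → ℚ, (∀ p, 0 ≤ c p) ∧
    ∀ n : ℕ, f n = ∑ p : Nat.Partition N,
      c p • (p.parts.map fun r => MvPolynomial.esymm (Fin n) ℚ r).prod

namespace EPosFamily

theorem zero (N : ℕ) : EPosFamily N fun _ => 0 :=
  ⟨0, fun _ => le_rfl, fun n => by simp⟩

theorem add {N : ℕ} {f g : ∀ n : ℕ, MvPolynomial (Fin n) ℚ} (hf : EPosFamily N f)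
    (hg : EPosFamily N g) : EPosFamily N fun n => f n + g n := by
  obtain ⟨c, hc, hf⟩ := hf
  obtain ⟨c', hc', hg⟩ := hg
  refine ⟨c + c', fun p => add_nonneg (hc p) (hc' p), fun n => ?_⟩
  simp [hf, hg, add_smul, Finset.sum_add_distrib]

theorem smul {N : ℕ} {f : ∀ n : ℕ, MvPolynomial (Fin n) ℚ} (hf : EPosFamily N f)
    {r : ℚ} (hr : 0 ≤ r) : EPosFamily N fun n => r • f n := by
  obtain ⟨c, hc, hf⟩ := hf
  refine ⟨fun p => r * c p, fun p => mul_nonneg hr (hc p), fun n => ?_⟩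
  simp [hf, Finset.smul_sum, mul_smul]

theorem sum {ι : Type*} {N : ℕ} {f : ι → ∀ n : ℕ, MvPolynomial (Fin n) ℚ} (s : Finset ι)
    (hf : ∀ j ∈ s, EPosFamily N (f j)) : EPosFamily N fun n => ∑ j ∈ s, f j n := by
  induction s using Finset.induction_on with
  | empty => simpa using zero N
  | insert j s hj ih =>
    simp only [Finset.sum_insert hj]
    exact add (hf j (by simp)) (ih fun k hk => hf k (by simp [hk]))

theorem esymm_prod {N : ℕ} (s : Multiset ℕ) (hs : s.sum = N) :
    EPosFamily N fun n => (s.map fun r => MvPolynomial.esymm (Fin n) ℚ r).prod := by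
  refine ⟨Pi.single (Nat.Partition.ofSums N s hs) 1, fun p => ?_, fun n => ?_⟩
  · by_cases h : p = Nat.Partition.ofSums N s hs
    · subst h; simp
    · simp [h]
  · rw [Finset.sum_eq_single (Nat.Partition.ofSums N s hs)]
    · simp only [Pi.single_eq_same, one_smul, Nat.Partition.ofSums]
      clear hs
      induction s using Multiset.induction_on with
      | empty => simp
      | cons k s ih =>
        by_cases hk : k = 0
        · simp [hk, ih]
        · simp [hk, ih]
    · intro p _ hp
      simp [hp]
    · simp

end EPosFamily

section DeletedEsymm

variable {σ R : Type*} [Fintype σ] [DecidableEq σ] [CommRing R]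

/-- The elementary symmetric polynomial in the variables other than the `i`-th,
evaluated at `y`. -/
def deletedEsymm (y : σ → R) (k : ℕ) (i : σ) : R :=
  ∑ T ∈ (Finset.univ.erase i).powersetCard k, ∏ j ∈ T, y j

/-- The elementary symmetric polynomial evaluated at `y`. -/
def evalEsymm (y : σ → R) (k : ℕ) : R :=
  ∑ T ∈ (Finset.univ : Finset σ).powersetCard k, ∏ j ∈ T, y j

theorem evalEsymm_succ (y : σ → R) (k : ℕ) (i : σ) :
    evalEsymm y (k + 1) = deletedEsymm y (k + 1) i + y i * deletedEsymm y k i := by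
  have hi : i ∉ Finset.univ.erase i := Finset.notMem_erase i _
  rw [evalEsymm, ← Finset.insert_erase (Finset.mem_univ i), Finset.powersetCard_succ_insert hi,
    Finset.sum_union]
  · rw [deletedEsymm, deletedEsymm, Finset.mul_sum]
    congr 1
    rw [Finset.sum_image]
    · refine Finset.sum_congr rfl fun T hT => ?_
      rw [Finset.prod_insert fun h => hi ((Finset.mem_powersetCard.1 hT).1 h)]
    · intro S hS T hT hST
      have hS' : i ∉ S := fun h => hi ((Finset.mem_powersetCard.1 hS).1 h)
      have hT' : i ∉ T := fun h => hi ((Finset.mem_powersetCard.1 hT).1 h)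
      rw [← Finset.erase_insert hS', ← Finset.erase_insert hT', hST]
  · rw [Finset.disjoint_left]
    intro S hS hS'
    obtain ⟨T, -, rfl⟩ := Finset.mem_image.1 hS'
    exact hi ((Finset.mem_powersetCard.1 hS).1 (Finset.mem_insert_self i T))

theorem sum_deletedEsymm (y : σ → R) (k : ℕ) :
    ∑ i, deletedEsymm y k i = ((Fintype.card σ : R) - k) * evalEsymm y k := by
  have h (i : σ) : deletedEsymm y k i =
      ∑ T ∈ (Finset.univ : Finset σ).powersetCard k, if i ∉ T then ∏ j ∈ T, y j else 0 := by
    rw [deletedEsymm, ← Finset.sum_filter]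
    refine Finset.sum_congr ?_ fun _ _ => rfl
    ext T
    simp only [Finset.mem_powersetCard, Finset.mem_filter, Finset.subset_univ, true_and,
      Finset.subset_erase]
    tauto
  simp only [h]
  rw [Finset.sum_comm, evalEsymm, Finset.mul_sum]
  refine Finset.sum_congr rfl fun T hT => ?_
  have hk : T.card = k := (Finset.mem_powersetCard.1 hT).2
  have hc : ((Finset.univ.filter fun i => i ∉ T).card : R) = (Fintype.card σ : R) - k := by
    rw [← hk, ← Finset.card_add_card_compl T, Finset.compl_eq_univ_sdiff,
      Finset.sdiff_eq_filter]
    push_cast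
    ring
  rw [← Finset.sum_filter, Finset.sum_const, nsmul_eq_mul, hc]

theorem deletedEsymm_zero (y : σ → R) (i : σ) : deletedEsymm y 0 i = 1 := by
  simp [deletedEsymm]

/-- The weighted sum arising from two cliques of sizes `a + 1` and `b + 1` sharing a vertex. -/
def cliquePairSum (y : σ → R) (a b : ℕ) : R :=
  ∑ i, y i * (deletedEsymm y a i * deletedEsymm y b i)

theorem cliquePairSum_comm (y : σ → R) (a b : ℕ) :
    cliquePairSum y a b = cliquePairSum y b a := by
  simp only [cliquePairSum, mul_comm (deletedEsymm y a _)]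

theorem cliquePairSum_eq (y : σ → R) (a b : ℕ) :
    cliquePairSum y a b = ((Fintype.card σ : R) - b) * (evalEsymm y (a + 1) * evalEsymm y b) -
      ∑ i, deletedEsymm y (a + 1) i * deletedEsymm y b i := by
  rw [mul_left_comm, ← sum_deletedEsymm, Finset.mul_sum, ← Finset.sum_sub_distrib, cliquePairSum]
  refine Finset.sum_congr rfl fun i _ => ?_
  rw [evalEsymm_succ y a i]
  ring

theorem cliquePairSum_succ (y : σ → R) (a b : ℕ) :
    cliquePairSum y a (b + 1) = ((a : R) - b) * (evalEsymm y (a + 1) * evalEsymm y (b + 1)) +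
      cliquePairSum y (a + 1) b := by
  rw [cliquePairSum_eq, cliquePairSum_comm y (a + 1) b, cliquePairSum_eq]
  simp only [mul_comm (deletedEsymm y (b + 1) _)]
  push_cast
  ring

theorem cliquePairSum_zero (y : σ → R) (a : ℕ) :
    cliquePairSum y a 0 = ((a : R) + 1) * evalEsymm y (a + 1) := by
  have h := sum_deletedEsymm y (a + 1)
  rw [cliquePairSum_eq]
  simp only [deletedEsymm_zero, mul_one, h]
  simp [evalEsymm]
  ring

end DeletedEsymm

theorem evalEsymm_X (n k : ℕ) :
    evalEsymm (MvPolynomial.X : Fin n → MvPolynomial (Fin n) ℚ) k =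
      MvPolynomial.esymm (Fin n) ℚ k := rfl

theorem EPosFamily.cliquePairSum_of_le (s : Multiset ℕ) (b : ℕ) :
    ∀ a : ℕ, b ≤ a → EPosFamily (s.sum + (a + 1 + b)) fun n =>
      (s.map fun r => MvPolynomial.esymm (Fin n) ℚ r).prod *
        cliquePairSum (MvPolynomial.X : Fin n → MvPolynomial (Fin n) ℚ) a b := by
  induction b with
  | zero =>
    intro a _
    have h := (EPosFamily.esymm_prod (N := s.sum + (a + 1 + 0)) ((a + 1) ::ₘ s)
      (by simp; ring)).smul (r := a + 1) (by positivity)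
    convert h using 2 with n
    rw [cliquePairSum_zero, evalEsymm_X, Multiset.map_cons, Multiset.prod_cons,
      MvPolynomial.smul_eq_C_mul]
    simp
    ring
  | succ b ih =>
    intro a hab
    have h := (EPosFamily.esymm_prod (N := s.sum + (a + 1 + (b + 1)))
      ((a + 1) ::ₘ (b + 1) ::ₘ s) (by simp; ring)).smul (r := (a : ℚ) - b)
      (sub_nonneg.2 (by exact_mod_cast (by omega : b ≤ a)))
    have h' := ih (a + 1) (by omega)
    rw [show a + 1 + 1 + b = a + 1 + (b + 1) by ring] at h'
    convert h.add h' using 2 with n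
    rw [cliquePairSum_succ, evalEsymm_X, evalEsymm_X, Multiset.map_cons, Multiset.prod_cons,
      Multiset.map_cons, Multiset.prod_cons, MvPolynomial.smul_eq_C_mul]
    simp
    ring

theorem EPosFamily.cliquePairSum (s : Multiset ℕ) (a b : ℕ) :
    EPosFamily (s.sum + (a + 1 + b)) fun n =>
      (s.map fun r => MvPolynomial.esymm (Fin n) ℚ r).prod *
        cliquePairSum (MvPolynomial.X : Fin n → MvPolynomial (Fin n) ℚ) a b := by
  rcases le_total b a with h | h
  · exact cliquePairSum_of_le s b a h
  · have := cliquePairSum_of_le s a b h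
    rw [show b + 1 + a = a + 1 + b by ring] at this
    simpa only [cliquePairSum_comm _ b a] using this

section InjectiveSums

variable {ι σ R : Type*} [Fintype ι] [DecidableEq ι] [Fintype σ] [DecidableEq σ] [CommRing R]

theorem card_injective_image_eq (T : Finset σ) (hT : T.card = Fintype.card ι) :
    (Finset.univ.filter fun v : ι → σ =>
      Function.Injective v ∧ Finset.univ.image v = T).card = (Fintype.card ι).factorial := by
  have hT' : Fintype.card ι = Fintype.card T := by simp [hT]
  rw [← Fintype.card_equiv (Fintype.equivOfCardEq hT'), ← Finset.card_univ]
  symm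
  refine Finset.card_bij (fun e _ t => (e t : σ)) ?_ ?_ ?_
  · intro e _
    simp only [Finset.mem_filter, Finset.mem_univ, true_and]
    refine ⟨Subtype.val_injective.comp e.injective, ?_⟩
    ext j
    simp only [Finset.mem_image, Finset.mem_univ, true_and]
    constructor
    · rintro ⟨t, rfl⟩
      exact (e t).2
    · intro hj
      exact ⟨e.symm ⟨j, hj⟩, by simp⟩
  · intro e _ e' _ h
    ext t
    exact congrFun h t
  · intro v hv
    simp only [Finset.mem_filter, Finset.mem_univ, true_and] at hv
    obtain ⟨hinj, rfl⟩ := hv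
    have hbij : Function.Bijective
        (fun t => (⟨v t, by simp⟩ : (Finset.univ.image v : Finset σ))) := by
      constructor
      · intro s t h
        exact hinj (congrArg Subtype.val h)
      · rintro ⟨j, hj⟩
        obtain ⟨t, -, rfl⟩ := Finset.mem_image.1 hj
        exact ⟨t, rfl⟩
    exact ⟨Equiv.ofBijective _ hbij, Finset.mem_univ _, rfl⟩

theorem sum_injective_prod (y : σ → R) (S : Finset σ) :
    ∑ v : ι → σ, (if Function.Injective v ∧ ∀ t, v t ∈ S then ∏ t, y (v t) else 0) =
      ((Fintype.card ι).factorial : R) *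
        ∑ T ∈ S.powersetCard (Fintype.card ι), ∏ j ∈ T, y j := by
  rw [← Finset.sum_filter, ← Finset.sum_fiberwise_of_maps_to
    (t := S.powersetCard (Fintype.card ι)) (g := fun v => Finset.univ.image v), Finset.mul_sum]
  · refine Finset.sum_congr rfl fun T hT => ?_
    obtain ⟨hTS, hTc⟩ := Finset.mem_powersetCard.1 hT
    rw [← card_injective_image_eq T hTc, ← nsmul_eq_mul, ← Finset.sum_const, Finset.filter_filter]
    refine Finset.sum_congr ?_ ?_
    · ext v
      simp only [Finset.mem_filter, Finset.mem_univ, true_and]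
      constructor
      · rintro ⟨⟨h, -⟩, h'⟩
        exact ⟨h, h'⟩
      · rintro ⟨h, rfl⟩
        exact ⟨⟨h, fun t => hTS (by simp)⟩, rfl⟩
    · intro v hv
      simp only [Finset.mem_filter, Finset.mem_univ, true_and] at hv
      rw [← hv.2, Finset.prod_image hv.1.injOn]
  · intro v hv
    simp only [Finset.mem_filter, Finset.mem_univ, true_and] at hv
    rw [Finset.mem_powersetCard, Finset.card_image_of_injective _ hv.1, Finset.card_univ]
    refine ⟨fun j hj => ?_, rfl⟩
    obtain ⟨t, -, rfl⟩ := Finset.mem_image.1 hj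
    exact hv.2 t

/-- The weight of the colour `c` at the position `t`, where the root `a` is forced to have
colour `i` and contributes no factor. -/
def rootWeight (y : σ → R) (a : ι) (i : σ) (t : ι) (c : σ) : R :=
  if t = a then (if c = i then 1 else 0) else y c

theorem sum_rootWeight (y : σ → R) (a : ι) (i : σ) (f : (ι → σ) → R) :
    ∑ w : ι → σ, f w * ∏ t, rootWeight y a i t (w t) =
      ∑ v : {t // t ≠ a} → σ, f ((Equiv.funSplitAt a σ).symm (i, v)) * ∏ t, y (v t) := by
  rw [← (Equiv.funSplitAt a σ).symm.sum_comp, Fintype.sum_prod_type, Finset.sum_eq_single i]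
  · refine Finset.sum_congr rfl fun v _ => ?_
    rw [Fintype.prod_eq_mul_prod_subtype_ne _ a]
    congr 1
    simp only [rootWeight, Equiv.funSplitAt, Equiv.piSplitAt]
    simp only [Equiv.coe_fn_symm_mk, dite_true, if_true, one_mul]
    refine Finset.prod_congr rfl fun t _ => ?_
    simp [t.2]
  · intro c _ hc
    refine Finset.sum_eq_zero fun v _ => ?_
    rw [Finset.prod_eq_zero (Finset.mem_univ a), mul_zero]
    simp [rootWeight, Equiv.funSplitAt, Equiv.piSplitAt, hc]
  · simp

theorem injective_funSplitAt_symm {ι σ : Type*} [DecidableEq ι] [Fintype σ]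
    [DecidableEq σ] (a : ι) (i : σ) (v : {t // t ≠ a} → σ) :
    Function.Injective ((Equiv.funSplitAt a σ).symm (i, v)) ↔
      Function.Injective v ∧ ∀ t, v t ∈ Finset.univ.erase i := by
  simp only [Function.Injective, Equiv.funSplitAt, Equiv.piSplitAt, Equiv.coe_fn_symm_mk,
    Finset.mem_erase, Finset.mem_univ, and_true]
  constructor
  · intro h
    refine ⟨fun s t hst => Subtype.ext (h ?_), fun t ht => t.2 (h ?_)⟩
    · simp [s.2, t.2, hst]
    · simp [t.2, ht]
  · rintro ⟨h, h'⟩ s t hst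
    by_cases hs : s = a <;> by_cases ht : t = a
    · rw [hs, ht]
    · subst hs
      simp only [ht, dite_true, dite_false] at hst
      exact absurd hst.symm (h' ⟨t, ht⟩)
    · subst ht
      simp only [hs, dite_true, dite_false] at hst
      exact absurd hst (h' ⟨s, hs⟩)
    · simp only [hs, ht, dite_false] at hst
      exact congrArg Subtype.val (h hst)

theorem sum_injective_rootWeight (y : σ → R) (a : ι) (i : σ) :
    ∑ w : ι → σ, (if Function.Injective w then 1 else 0) * ∏ t, rootWeight y a i t (w t) =
      ((Fintype.card ι - 1).factorial : R) * deletedEsymm y (Fintype.card ι - 1) i := by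
  rw [sum_rootWeight]
  simp only [injective_funSplitAt_symm, ite_mul, one_mul, zero_mul]
  rw [sum_injective_prod, deletedEsymm]
  simp

end InjectiveSums

section Partitions

variable {d : ℕ}

theorem blockOf_eq_part (π : SetPtn d) (a : Fin d) : blockOf π a = π.part a := by
  ext k
  rw [Finpartition.mem_part_iff_exists]
  simp [blockOf, sameBlock, and_comm]

theorem blockOf_mem (π : SetPtn d) (a : Fin d) : blockOf π a ∈ π.parts := by
  rw [blockOf_eq_part]
  simp

theorem mem_blockOf_self (π : SetPtn d) (a : Fin d) : a ∈ blockOf π a := by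
  rw [blockOf_eq_part]
  simp

theorem eq_blockOf_of_mem (π : SetPtn d) {a : Fin d} {B : Finset (Fin d)} (hB : B ∈ π.parts)
    (ha : a ∈ B) : B = blockOf π a := by
  rw [blockOf_eq_part, π.part_eq_of_mem hB ha]

theorem ptype_snd_pos (π : SetPtn d) (a : Fin d) : 0 < (ptype π a).2 :=
  Finset.card_pos.2 ⟨a, mem_blockOf_self π a⟩

theorem ptype_sum (π : SetPtn d) (a : Fin d) : (ptype π a).1.sum + (ptype π a).2 = d := by
  have h := π.sum_card_parts
  rw [← Finset.sum_erase_add _ _ (blockOf_mem π a)] at h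
  simpa [ptype, Finset.sum] using h

theorem restrict_parts_bijective {σ : Type*} (π : SetPtn d) :
    Function.Bijective
      (fun (w : Fin d → σ) (B : π.parts) (t : (B : Finset (Fin d))) => w t) := by
  constructor
  · intro w w' h
    ext t
    exact congrFun (congrFun h ⟨_, blockOf_mem π t⟩) ⟨t, mem_blockOf_self π t⟩
  · intro U
    refine ⟨fun t => U ⟨_, blockOf_mem π t⟩ ⟨t, mem_blockOf_self π t⟩, ?_⟩
    ext B t
    have key (C : Finset (Fin d)) (hC : C ∈ π.parts) (ht : (t : Fin d) ∈ C)
        (h : C = B.1) : U ⟨C, hC⟩ ⟨t, ht⟩ = U B t := by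
      subst h
      rfl
    exact key _ _ _ (eq_blockOf_of_mem π B.2 t.2).symm

theorem sum_prod_parts {σ R : Type*} [Fintype σ] [CommRing R] (π : SetPtn d)
    (h : ∀ B : Finset (Fin d), (B → σ) → R) :
    ∑ w : Fin d → σ, ∏ B ∈ π.parts, h B (fun t => w t) =
      ∏ B ∈ π.parts, ∑ u : B → σ, h B u := by
  rw [← Finset.prod_coe_sort π.parts fun B => ∑ u : B → σ, h B u, Finset.prod_univ_sum,
    Fintype.piFinset_univ, ← (Equiv.ofBijective _ (restrict_parts_bijective π)).sum_comp]
  refine Finset.sum_congr rfl fun w _ => ?_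
  rw [← Finset.prod_coe_sort π.parts]
  rfl

theorem prod_parts_prod {M : Type*} [CommMonoid M] (π : SetPtn d) (g : Fin d → M) :
    ∏ B ∈ π.parts, ∏ t : B, g t = ∏ t, g t := by
  simp only [Finset.prod_coe_sort]
  have h := Finset.prod_biUnion (f := g) π.supIndep.pairwiseDisjoint
  rw [π.biUnion_parts] at h
  exact h.symm

/-- A colouring with finitely many colours, as a word in the positive integers. -/
def colourWord {n : ℕ} (w : Fin d → Fin n) : NCWord d := fun t => (w t : ℕ).succPNat

theorem colourWord_eq_iff {n : ℕ} (w : Fin d → Fin n) (j k : Fin d) :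
    colourWord w j = colourWord w k ↔ w j = w k := by
  simp [colourWord, Fin.ext_iff]

theorem eSP_colourWord {n : ℕ} (π : SetPtn d) (w : Fin d → Fin n) :
    eSP π (colourWord w) =
      ∏ B ∈ π.parts, if Function.Injective (fun t : B => w t) then (1 : ℚ) else 0 := by
  rw [Finset.prod_ite_zero, Finset.prod_const_one, eSP]
  have key : (∀ j k : Fin d, j ≠ k → sameBlock π j k → colourWord w j ≠ colourWord w k) ↔
      ∀ B ∈ π.parts, Function.Injective (fun t : B => w t) := by
    constructor
    · intro h B hB s t hst
      by_contra hne
      exact h s t (fun hs => hne (Subtype.ext hs)) ⟨B, hB, s.2, t.2⟩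
        ((colourWord_eq_iff w _ _).2 hst)
    · rintro h j k hjk ⟨B, hB, hj, hk⟩ hw
      exact hjk (congrArg Subtype.val
        (@h B hB ⟨j, hj⟩ ⟨k, hk⟩ ((colourWord_eq_iff w _ _).1 hw)))
  simp only [key]
  congr

/-- The sum over all colourings with `n` colours that give the root `a` the colour `i`, each
weighted by a coefficient function and by the colours of the other vertices. -/
def rootedSum (a : Fin d) (n : ℕ) (i : Fin n) : Md d →ₗ[ℚ] MvPolynomial (Fin n) ℚ :=
  ∑ w : Fin d → Fin n,
    (LinearMap.proj (R := ℚ) (φ := fun _ : NCWord d => ℚ) (colourWord w)).smulRight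
      (∏ t, rootWeight MvPolynomial.X a i t (w t))

theorem rootedSum_apply (a : Fin d) (n : ℕ) (i : Fin n) (f : Md d) :
    rootedSum a n i f = ∑ w : Fin d → Fin n,
      MvPolynomial.C (f (colourWord w)) *
        ∏ t, rootWeight MvPolynomial.X a i t (w t) := by
  simp [rootedSum, MvPolynomial.smul_eq_C_mul]

theorem rootedSum_eSP (a : Fin d) (n : ℕ) (i : Fin n) (π : SetPtn d) :
    rootedSum a n i (eSP π) =
      ((ptype π a).1.map fun k =>
        (k.factorial : MvPolynomial (Fin n) ℚ) * MvPolynomial.esymm (Fin n) ℚ k).prod *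
      ((((ptype π a).2 - 1).factorial : MvPolynomial (Fin n) ℚ) *
        deletedEsymm MvPolynomial.X ((ptype π a).2 - 1) i) := by
  have hsum : rootedSum a n i (eSP π) = ∑ w : Fin d → Fin n, ∏ B ∈ π.parts,
      ((if Function.Injective (fun t : B => w t) then 1 else 0) *
        ∏ t : B, rootWeight MvPolynomial.X a i (t : Fin d) (w t)) := by
    rw [rootedSum_apply]
    refine Finset.sum_congr rfl fun w _ => ?_
    rw [Finset.prod_mul_distrib,
      prod_parts_prod π fun t => rootWeight MvPolynomial.X a i t (w t), eSP_colourWord, map_prod]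
    simp only [apply_ite MvPolynomial.C, map_one, map_zero]
  rw [hsum, sum_prod_parts π fun B u => (if Function.Injective u then 1 else 0) *
    ∏ t : B, rootWeight MvPolynomial.X a i (t : Fin d) (u t),
    ← Finset.prod_erase_mul _ _ (blockOf_mem π a)]
  congr 1
  · simp only [ptype, Multiset.map_map]
    refine Finset.prod_congr rfl fun B hB => ?_
    have haB : a ∉ B := fun h =>
      Finset.ne_of_mem_erase hB (eq_blockOf_of_mem π (Finset.mem_of_mem_erase hB) h)
    have hw (t : B) (c : Fin n) : rootWeight MvPolynomial.X a i (t : Fin d) c =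
        (MvPolynomial.X c : MvPolynomial (Fin n) ℚ) :=
      by
      have hta : (t : Fin d) ≠ a := fun h => haB (h ▸ t.2)
      rw [rootWeight, if_neg hta]
    have h := sum_injective_prod (ι := B)
      (MvPolynomial.X : Fin n → MvPolynomial (Fin n) ℚ) Finset.univ
    simp only [Finset.mem_univ, implies_true, and_true, Fintype.card_coe] at h
    simp only [hw, ite_mul, one_mul, zero_mul, Function.comp_apply]
    exact h
  · have h := sum_injective_rootWeight (MvPolynomial.X : Fin n → MvPolynomial (Fin n) ℚ)
      (⟨a, mem_blockOf_self π a⟩ : blockOf π a) i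
    simp only [rootWeight, Subtype.ext_iff, Fintype.card_coe] at h
    exact h

theorem rootedSum_eq_zero_of_mem_Ksub (a : Fin d) (n : ℕ) (i : Fin n) {f : Md d}
    (hf : f ∈ Ksub a) : rootedSum a n i f = 0 := by
  have hle : Ksub a ≤ LinearMap.ker (rootedSum a n i) := by
    refine Submodule.span_le.2 ?_
    rintro f ⟨π₁, π₂, h, rfl⟩
    simp [rootedSum_eSP, h]
  exact hle hf

end Partitions

section Concatenation

theorem rootedSum_YG {d : ℕ} (a : Fin d) (n : ℕ) (i : Fin n) (G : SimpleGraph (Fin d)) :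
    rootedSum a n i (YG G) = ∑ v : {t // t ≠ a} → Fin n,
      (if ∀ j k, G.Adj j k → (Equiv.funSplitAt a (Fin n)).symm (i, v) j ≠
        (Equiv.funSplitAt a (Fin n)).symm (i, v) k then 1 else 0) *
          ∏ t, (MvPolynomial.X (v t) : MvPolynomial (Fin n) ℚ) := by
  rw [rootedSum_apply, sum_rootWeight _ a i fun w => MvPolynomial.C (YG G (colourWord w))]
  simp only [YG, ne_eq, colourWord_eq_iff, apply_ite MvPolynomial.C, map_one, map_zero]

theorem forall_concat_rev_adj_ne_iff (A B : LGraph) {α : Type*}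
    (κ : Fin (A.concat B.rev).n → α) :
    (∀ j k, (A.concat B.rev).G.Adj j k → κ j ≠ κ k) ↔
      (∀ j k, A.G.Adj j k → κ ⟨j, by have := B.npos; simp [LGraph.concat, LGraph.rev]; omega⟩ ≠
        κ ⟨k, by have := B.npos; simp [LGraph.concat, LGraph.rev]; omega⟩) ∧
      (∀ j k, B.G.Adj j k →
        κ ⟨B.n - 1 - j + (A.n - 1), by
          have := A.npos; have := j.2; simp [LGraph.concat, LGraph.rev]; omega⟩ ≠
        κ ⟨B.n - 1 - k + (A.n - 1), by
          have := A.npos; have := k.2; simp [LGraph.concat, LGraph.rev]; omega⟩) := by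
  have hadj (j k : Fin (A.concat B.rev).n) : (A.concat B.rev).G.Adj j k ↔
      (concatG A.G (revG B.G)).Adj j k := Iff.rfl
  simp only [hadj, concatG]
  constructor
  · intro h
    constructor
    · intro j k hjk
      refine h _ _ ⟨fun he => hjk.ne (Fin.ext (congrArg Fin.val he :)),
        Or.inl (Or.inl ⟨j, k, hjk, rfl, rfl⟩)⟩
    · intro j k hjk
      have hj := j.2
      have hk := k.2
      refine h _ _ ⟨fun he => hjk.ne (Fin.ext ?_), Or.inl (Or.inr
        ⟨⟨B.n - 1 - j, by omega⟩, ⟨B.n - 1 - k, by omega⟩, ?_, rfl, rfl⟩)⟩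
      · have he' : B.n - 1 - (j : ℕ) + (A.n - 1) = B.n - 1 - (k : ℕ) + (A.n - 1) :=
          congrArg Fin.val he
        omega
      · simp only [revG, SimpleGraph.comap_adj]
        convert hjk using 1 <;> (ext; simp only; omega)
  · rintro ⟨hA, hB⟩
    have key (j k : Fin (A.concat B.rev).n)
        (h : (∃ i l : Fin A.n, A.G.Adj i l ∧ (j : ℕ) = i ∧ (k : ℕ) = l) ∨
          (∃ i l : Fin B.n, (revG B.G).Adj i l ∧ (j : ℕ) = i + (A.n - 1) ∧
            (k : ℕ) = l + (A.n - 1))) : κ j ≠ κ k := by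
      rcases h with ⟨i, l, h, hj, hk⟩ | ⟨i, l, h, hj, hk⟩
      · convert hA i l h using 2 <;> (ext; assumption)
      · have hi := i.2
        have hl := l.2
        convert hB _ _ h using 2 <;> (ext; simp only; omega)
    rintro j k ⟨-, h | h⟩
    · exact key j k h
    · exact (key k j h).symm

/-- The vertices of `A + B^r`: the shared vertex and the remaining vertices of `A` and `B`. -/
def glueVertex (A B : LGraph) :
    Option ({t // t ≠ A.last} ⊕ {t // t ≠ B.last}) → Fin (A.concat B.rev).n
  | none => ⟨A.n - 1, by
      have := A.npos; have := B.npos; simp [LGraph.concat, LGraph.rev]; omega⟩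
  | some (Sum.inl t) => ⟨t, by
      have := B.npos; simp [LGraph.concat, LGraph.rev]; omega⟩
  | some (Sum.inr t) => ⟨B.n - 1 - t + (A.n - 1), by
      have := A.npos; have := t.1.2; simp [LGraph.concat, LGraph.rev]; omega⟩

theorem glueVertex_bijective (A B : LGraph) : Function.Bijective (glueVertex A B) := by
  have hA := A.npos
  have hB := B.npos
  rw [Fintype.bijective_iff_injective_and_card]
  constructor
  · have hl (t : {t // t ≠ A.last}) : (t : ℕ) < A.n - 1 := by
      have h := t.2
      have := t.1.2
      simp only [LGraph.last, ne_eq, Fin.ext_iff] at h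
      omega
    have hr (t : {t // t ≠ B.last}) : (t : ℕ) < B.n - 1 := by
      have h := t.2
      have := t.1.2
      simp only [LGraph.last, ne_eq, Fin.ext_iff] at h
      omega
    rintro (_ | s | s) (_ | t | t) h <;>
      simp only [glueVertex, reduceCtorEq, Option.some.injEq, Sum.inl.injEq,
        Sum.inr.injEq, Subtype.ext_iff, Fin.ext_iff] at h ⊢
    · have := hl t; omega
    · have := hr t; omega
    · have := hl s; omega
    · exact h
    · have := hl s; omega
    · have := hr s; omega
    · have := hl t; omega
    · have := hr s; have := hr t; omega
  · have hcard : Fintype.card (Fin (A.concat B.rev).n) = A.n + B.n - 1 := Fintype.card_fin _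
    rw [hcard]
    simp
    omega

theorem cspoly_concat_rev (A B : LGraph) (n : ℕ) :
    cspoly (A.concat B.rev).G n = ∑ i : Fin n, MvPolynomial.X i *
      (rootedSum A.last n i (YG A.G) * rootedSum B.last n i (YG B.G)) := by
  let e := Equiv.ofBijective _ (glueVertex_bijective A B)
  let E := (((Equiv.arrowCongr e (Equiv.refl (Fin n))).symm.trans
    Equiv.piOptionEquivProd).trans
      (Equiv.prodCongr (Equiv.refl _) (Equiv.sumArrowEquivProdArrow _ _ _))).symm
  rw [cspoly, Finset.sum_filter, ← E.sum_comp, Fintype.sum_prod_type]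
  refine Finset.sum_congr rfl fun i _ => ?_
  rw [rootedSum_YG, rootedSum_YG, Finset.sum_mul_sum, Finset.mul_sum, Fintype.sum_prod_type]
  refine Finset.sum_congr rfl fun u _ => ?_
  rw [Finset.mul_sum]
  refine Finset.sum_congr rfl fun v _ => ?_
  have hE (x) : E (i, u, v) (e x) = Option.elim x i (Sum.elim u v) := by
    change (Equiv.piOptionEquivProd (β := fun _ => Fin n)).symm (i, Sum.elim u v) (e.symm (e x)) = _
    rw [e.symm_apply_apply]
    cases x <;> rfl
  have hleft (t : Fin A.n) (ht) : E (i, u, v) ⟨t, ht⟩ =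
      (Equiv.funSplitAt A.last (Fin n)).symm (i, u) t := by
    by_cases h : t = A.last
    · subst h
      exact (hE none).trans (by simp [Equiv.funSplitAt, Equiv.piSplitAt])
    · exact (hE (some (Sum.inl ⟨t, h⟩))).trans (by simp [Equiv.funSplitAt, Equiv.piSplitAt, h])
  have hright (t : Fin B.n) (ht) : E (i, u, v) ⟨B.n - 1 - t + (A.n - 1), ht⟩ =
      (Equiv.funSplitAt B.last (Fin n)).symm (i, v) t := by
    by_cases h : t = B.last
    · subst h
      have h0 : (⟨B.n - 1 - (B.last : ℕ) + (A.n - 1), ht⟩ : Fin (A.concat B.rev).n) = e none := by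
        apply Fin.ext
        change B.n - 1 - (B.n - 1) + (A.n - 1) = A.n - 1
        omega
      rw [h0, hE]
      simp [Equiv.funSplitAt, Equiv.piSplitAt]
    · exact (hE (some (Sum.inr ⟨t, h⟩))).trans (by simp [Equiv.funSplitAt, Equiv.piSplitAt, h])
  have hprod : ∏ t, (MvPolynomial.X (E (i, u, v) t) : MvPolynomial (Fin n) ℚ) =
      MvPolynomial.X i * ((∏ t, MvPolynomial.X (u t)) * ∏ t, MvPolynomial.X (v t)) := by
    rw [← e.prod_comp]
    simp only [hE, Fintype.prod_option, Fintype.prod_sum_type, Option.elim, Sum.elim_inl,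
      Sum.elim_inr]
  simp only [forall_concat_rev_adj_ne_iff, hleft, hright, hprod, ite_and]
  split_ifs <;> simp

end Concatenation

theorem EPosFamily.rootedSum_mul {p q : ℕ} (a : Fin p) (b : Fin q) (π : SetPtn p)
    (ρ : SetPtn q) : EPosFamily (p + q - 1) fun n => ∑ i : Fin n, MvPolynomial.X i *
      (rootedSum a n i (eSP π) * rootedSum b n i (eSP ρ)) := by
  set s := ptype π a with hs
  set t := ptype ρ b with ht
  have h := (EPosFamily.cliquePairSum (s.1 + t.1) (s.2 - 1) (t.2 - 1)).smul
    (r := ((((s.1 + t.1).map Nat.factorial).prod * (s.2 - 1).factorial * (t.2 - 1).factorial : ℕ)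
      : ℚ)) (Nat.cast_nonneg _)
  have hN : (s.1 + t.1).sum + (s.2 - 1 + 1 + (t.2 - 1)) = p + q - 1 := by
    have hp : s.1.sum + s.2 = p := ptype_sum π a
    have hq : t.1.sum + t.2 = q := ptype_sum ρ b
    have hs_pos : 0 < s.2 := ptype_snd_pos π a
    have ht_pos : 0 < t.2 := ptype_snd_pos ρ b
    rw [Multiset.sum_add]
    omega
  rw [hN] at h
  convert h using 2 with n
  have hfac (m : Multiset ℕ) : (m.map fun k => (k.factorial : MvPolynomial (Fin n) ℚ) *
      MvPolynomial.esymm (Fin n) ℚ k).prod =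
      ((m.map Nat.factorial).prod : ℕ) * (m.map fun k => MvPolynomial.esymm (Fin n) ℚ k).prod := by
    rw [Multiset.prod_map_mul, Nat.cast_multiset_prod, Multiset.map_map]
    rfl
  simp only [rootedSum_eSP, ← hs, ← ht, hfac]
  rw [_root_.cliquePairSum, Finset.mul_sum, Finset.smul_sum]
  refine Finset.sum_congr rfl fun i _ => ?_
  rw [MvPolynomial.smul_eq_C_mul, map_natCast, Multiset.map_add, Multiset.prod_add,
    Multiset.map_add, Multiset.prod_add]
  push_cast
  ring

theorem IsEPosNCAt.exists_rootedSum_eq {d : ℕ} {G : SimpleGraph (Fin d)} {a : Fin d}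
    (h : IsEPosNCAt G a) : ∃ (s : Finset (SetPtn d)) (c : SetPtn d → ℚ), (∀ π, 0 ≤ c π) ∧
      ∀ (n : ℕ) (i : Fin n),
        rootedSum a n i (YG G) = ∑ π ∈ s, c π • rootedSum a n i (eSP π) := by
  obtain ⟨s, c, hc, hK⟩ := h
  refine ⟨s, c, hc, fun n i => ?_⟩
  have := rootedSum_eq_zero_of_mem_Ksub a n i hK
  rw [map_sub, sub_eq_zero] at this
  simpa using this

theorem stmt12 (A B : LGraph) (hA : A.EPosNC) (hB : B.EPosNC) :
    EPos (A.concat B.rev).G := by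
  obtain ⟨s, c, hc, hs⟩ := hA.exists_rootedSum_eq
  obtain ⟨t, c', hc', ht⟩ := hB.exists_rootedSum_eq
  have h : EPosFamily (A.n + B.n - 1) fun n => cspoly (A.concat B.rev).G n := by
    have hsum := EPosFamily.sum s fun π _ => EPosFamily.sum t fun ρ _ =>
      (EPosFamily.rootedSum_mul A.last B.last π ρ).smul (mul_nonneg (hc π) (hc' ρ))
    convert hsum using 2 with n
    simp only [cspoly_concat_rev, hs, ht, Finset.sum_mul_sum, Finset.smul_sum]
    simp only [Finset.mul_sum]
    rw [Finset.sum_comm]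
    refine Finset.sum_congr rfl fun π _ => ?_
    rw [Finset.sum_comm]
    refine Finset.sum_congr rfl fun ρ _ => Finset.sum_congr rfl fun i _ => ?_
    simp only [MvPolynomial.smul_eq_C_mul, map_mul]
    ring
  have hcard : A.n + B.n - 1 = Fintype.card (Fin (A.concat B.rev).n) :=
    (Fintype.card_fin _).symm
  rw [hcard] at h
  exact h
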